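/- Let p be an odd prime, let f : ℤ_p → ℤ_p be everywhere analytic with integral coefficients, let λ ∈ ℚ_p with ‖λ‖_p > 1, and let n ∈ ℕ with n ≥ 1. Then both Volkenborn integrals below exist and ζ_p^f(1−n,λ) = −(1/n)·ω_v(λ)^{−n}·B_n^f(λ); explicitly, lim_{N→∞} p^{−N} Σ_{a=0}^{p^N−1} ⟨λ+f(a)⟩^n = ω_v(λ)^{−n} · lim_{N→∞} p^{−N} Σ_{a=0}^{p^N−1} (λ+f(a))^n. -/

import Mathlib

open Filter Topology

namespace PZeta

variable (p : ℕ) [Fact p.Prime]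

/-- The `N`-th partial sum defining the fermionic integral
`∫_{ℤ_p} g dμ₋₁ = lim_N Σ_{a=0}^{p^N-1} (-1)^a g(a)`. -/
noncomputable def fermSum (g : ℤ_[p] → ℚ_[p]) (N : ℕ) : ℚ_[p] :=
  ∑ a ∈ Finset.range (p ^ N), (-1 : ℚ_[p]) ^ a * g (a : ℤ_[p])

/-- The `N`-th partial sum defining the Volkenborn integral
`∫_{ℤ_p} g da = lim_N p^{-N} Σ_{a=0}^{p^N-1} g(a)`. -/
noncomputable def volkSum (g : ℤ_[p] → ℚ_[p]) (N : ℕ) : ℚ_[p] :=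
  ((p : ℚ_[p]) ^ N)⁻¹ * ∑ a ∈ Finset.range (p ^ N), g (a : ℤ_[p])

/-- The unit part `x·p^{-v_p(x)}` of a nonzero `p`-adic number. -/
noncomputable def unitPart (x : ℚ_[p]) : ℚ_[p] := x * (p : ℚ_[p]) ^ (-x.valuation)

/-- The Teichmüller representative of a `p`-adic unit, `lim_n x^{p^n}`. -/
noncomputable def teich (x : ℚ_[p]) : ℚ_[p] :=
  limUnder atTop fun n : ℕ => x ^ p ^ n

/-- The projection `⟨x⟩ ∈ 1 + pℤ_p`, via `x = p^{v_p(x)}·ζ·⟨x⟩`. -/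
noncomputable def angle (x : ℚ_[p]) : ℚ_[p] := unitPart p x / teich p (unitPart p x)

/-- `ω_v(x) := x / ⟨x⟩ = p^{v_p(x)}·ζ`. -/
noncomputable def omegaV (x : ℚ_[p]) : ℚ_[p] := x / angle p x

/-- The generalized binomial coefficient `C(t,n) = t(t-1)⋯(t-n+1)/n!`. -/
noncomputable def gbinom (t : ℚ_[p]) (n : ℕ) : ℚ_[p] :=
  (∏ i ∈ Finset.range n, (t - (i : ℚ_[p]))) / (n.factorial : ℚ_[p])

/-- The power `y^t` defined by the binomial series `Σ_n C(t,n)(y-1)^n`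
(used for `y ∈ 1 + pℤ_p` and `t ∈ ℤ_p`). -/
noncomputable def bpow (y t : ℚ_[p]) : ℚ_[p] := ∑' n : ℕ, gbinom p t n * (y - 1) ^ n

/-- The Iwasawa `p`-adic logarithm: `log_p x = Σ_{n≥1} (-1)^{n+1}(⟨x⟩-1)^n/n`
(one has `log_p p = 0` and `log_p ζ = 0` for roots of unity of order prime to `p`). -/
noncomputable def padicLog (x : ℚ_[p]) : ℚ_[p] :=
  ∑' n : ℕ, (-1 : ℚ_[p]) ^ n * (angle p x - 1) ^ (n + 1) / ((n : ℚ_[p]) + 1)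

/-- The power `y^t` defined by the exponential series `Σ_n (t·log_p y)^n/n!`
(used for `y ∈ 1 + pℤ_p` and `‖t‖ < p^{(p-2)/(p-1)}`). -/
noncomputable def epow (y t : ℚ_[p]) : ℚ_[p] :=
  ∑' n : ℕ, (t * padicLog p y) ^ n / (n.factorial : ℚ_[p])

/-- `f : ℤ_p → ℤ_p` is everywhere analytic with integral coefficients:
`f(x) = Σ_k c_k x^k` with `‖c_k‖ ≤ 1`, `c_k → 0`. -/
def EverywhereAnalytic (f : ℤ_[p] → ℤ_[p]) : Prop :=
  ∃ c : ℕ → ℚ_[p], (∀ k, ‖c k‖ ≤ 1) ∧ Tendsto c atTop (𝓝 0) ∧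
    ∀ x : ℤ_[p], (f x : ℚ_[p]) = ∑' k : ℕ, c k * (x : ℚ_[p]) ^ k

/-- The `p`-adic Hurwitz-type Euler zeta function w.r.t. `f`:
`ζ_{p,E}^f(s,λ) = ∫_{ℤ_p} ⟨λ+f(a)⟩^{1-s} dμ₋₁(a)`. -/
noncomputable def zetaE (f : ℤ_[p] → ℤ_[p]) (s : ℤ_[p]) (lam : ℚ_[p]) : ℚ_[p] :=
  limUnder atTop
    (fermSum p fun a => bpow p (angle p (lam + (f a : ℚ_[p]))) (1 - (s : ℚ_[p])))

/-- The `p`-adic Hurwitz zeta function w.r.t. `f`: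
`ζ_p^f(s,λ) = (s-1)⁻¹ ∫_{ℤ_p} ⟨λ+f(a)⟩^{1-s} da`. -/
noncomputable def zetaH (f : ℤ_[p] → ℤ_[p]) (s : ℤ_[p]) (lam : ℚ_[p]) : ℚ_[p] :=
  ((s : ℚ_[p]) - 1)⁻¹ *
    limUnder atTop
      (volkSum p fun a => bpow p (angle p (lam + (f a : ℚ_[p]))) (1 - (s : ℚ_[p])))

end PZeta

open PZeta

namespace PZeta

section

variable {p : ℕ} [Fact p.Prime]

/-- `g (x + y) = g x + y * h x` up to an error of size at most `C * ‖y‖ ^ 2`. -/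
def FirstOrderExpansion (g h : ℤ_[p] → ℚ_[p]) (C : ℝ) : Prop :=
  ∀ x y : ℤ_[p], ‖g (x + y) - g x - y * h x‖ ≤ C * ‖y‖ ^ 2

namespace FirstOrderExpansion

variable {g h g₁ h₁ g₂ h₂ : ℤ_[p] → ℚ_[p]} {C C₁ C₂ : ℝ}

theorem const_nonneg (hg : FirstOrderExpansion g h C) : 0 ≤ C := by
  simpa using (norm_nonneg _).trans (hg 0 1)

/-- The first-order coefficient is Lipschitz. -/
theorem norm_coeff_add_sub_le (hg : FirstOrderExpansion g h C) (x y : ℤ_[p]) :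
    ‖h (x + y) - h x‖ ≤ C * ‖y‖ := by
  rcases eq_or_ne y 0 with rfl | hy
  · simp
  have key : (y : ℚ_[p]) * (h (x + y) - h x) =
      (g (x + y) - g x - y * h x) +
        (g (x + y + -y) - g (x + y) - ((-y : ℤ_[p]) : ℚ_[p]) * h (x + y)) := by
    rw [add_neg_cancel_right]; push_cast; ring
  have hle : ‖(y : ℚ_[p]) * (h (x + y) - h x)‖ ≤ C * ‖y‖ ^ 2 := by
    rw [key]
    refine (IsUltrametricDist.norm_add_le_max _ _).trans (max_le (hg x y) ?_)
    simpa only [norm_neg] using hg (x + y) (-y)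
  rw [norm_mul, ← PadicInt.norm_def] at hle
  have hpos : 0 < ‖y‖ := norm_pos_iff.mpr hy
  nlinarith

theorem norm_coeff_le (hg : FirstOrderExpansion g h C) (x : ℤ_[p]) :
    ‖h x‖ ≤ C + ‖h 0‖ := by
  have h1 := hg.norm_coeff_add_sub_le 0 x
  rw [zero_add] at h1
  have h2 : ‖h x‖ ≤ ‖h x - h 0‖ + ‖h 0‖ := by simpa using norm_add_le (h x - h 0) (h 0)
  have h3 := mul_le_mul_of_nonneg_left (PadicInt.norm_le_one x) hg.const_nonneg
  linarith

theorem norm_add_sub_le (hg : FirstOrderExpansion g h C) (x y : ℤ_[p]) :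
    ‖g (x + y) - g x‖ ≤ (2 * C + ‖h 0‖) * ‖y‖ := by
  have h1 : ‖g (x + y) - g x‖ ≤ ‖g (x + y) - g x - y * h x‖ + ‖(y : ℚ_[p]) * h x‖ := by
    simpa using norm_add_le (g (x + y) - g x - y * h x) (y * h x)
  rw [norm_mul, ← PadicInt.norm_def] at h1
  have h2 := mul_le_mul_of_nonneg_left (hg.norm_coeff_le x) (norm_nonneg y)
  have h3 : C * ‖y‖ ^ 2 ≤ C * ‖y‖ :=
    mul_le_mul_of_nonneg_left (pow_le_of_le_one (norm_nonneg _) (PadicInt.norm_le_one y) two_ne_zero)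
      hg.const_nonneg
  linarith [hg x y]

theorem exists_norm_le (hg : FirstOrderExpansion g h C) : ∃ D, ∀ x, ‖g x‖ ≤ D := by
  refine ⟨2 * C + ‖h 0‖ + ‖g 0‖, fun x => ?_⟩
  have h1 := hg.norm_add_sub_le 0 x
  rw [zero_add] at h1
  have h2 : ‖g x‖ ≤ ‖g x - g 0‖ + ‖g 0‖ := by simpa using norm_add_le (g x - g 0) (g 0)
  have hc : 0 ≤ 2 * C + ‖h 0‖ := by linarith [hg.const_nonneg, norm_nonneg (h 0)]
  have h3 := mul_le_mul_of_nonneg_left (PadicInt.norm_le_one x) hc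
  linarith

theorem const_add (hg : FirstOrderExpansion g h C) (c : ℚ_[p]) :
    FirstOrderExpansion (fun x => c + g x) h C := fun x y => by
  simpa only [add_sub_add_left_eq_sub] using hg x y

theorem exists_mul (hg₁ : FirstOrderExpansion g₁ h₁ C₁) (hg₂ : FirstOrderExpansion g₂ h₂ C₂) :
    ∃ C, FirstOrderExpansion (fun x => g₁ x * g₂ x) (fun x => g₁ x * h₂ x + h₁ x * g₂ x) C := by
  obtain ⟨D₁, hD₁⟩ := hg₁.exists_norm_le
  obtain ⟨D₂, hD₂⟩ := hg₂.exists_norm_le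
  refine ⟨D₁ * C₂ + C₁ * D₂ + (2 * C₁ + ‖h₁ 0‖) * (2 * C₂ + ‖h₂ 0‖), fun x y => ?_⟩
  have key : g₁ (x + y) * g₂ (x + y) - g₁ x * g₂ x - y * (g₁ x * h₂ x + h₁ x * g₂ x) =
      g₁ x * (g₂ (x + y) - g₂ x - y * h₂ x) + (g₁ (x + y) - g₁ x - y * h₁ x) * g₂ x +
        (g₁ (x + y) - g₁ x) * (g₂ (x + y) - g₂ x) := by ring
  rw [key]
  refine (norm_add₃_le).trans ?_
  simp only [norm_mul]
  have e1 := mul_le_mul (hD₁ x) (hg₂ x y) (norm_nonneg _) ((norm_nonneg _).trans (hD₁ x))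
  have e2 := mul_le_mul (hg₁ x y) (hD₂ x) (norm_nonneg _) ((norm_nonneg _).trans (hg₁ x y))
  have e3 := mul_le_mul (hg₁.norm_add_sub_le x y) (hg₂.norm_add_sub_le x y) (norm_nonneg _)
    ((norm_nonneg _).trans (hg₁.norm_add_sub_le x y))
  linarith

theorem exists_pow (hg : FirstOrderExpansion g h C) (n : ℕ) :
    ∃ h' C', FirstOrderExpansion (fun x => g x ^ n) h' C' := by
  induction n with
  | zero => exact ⟨0, 0, fun x y => by simp⟩
  | succ n ih =>
    obtain ⟨h', C', hn⟩ := ih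
    obtain ⟨C'', hC''⟩ := hn.exists_mul hg
    exact ⟨_, C'', by simpa only [pow_succ] using hC''⟩

end FirstOrderExpansion

theorem sum_range_mul_eq {M : Type*} [AddCommMonoid M] (F : ℕ → M) (m q : ℕ) :
    ∑ a ∈ Finset.range (m * q), F a =
      ∑ j ∈ Finset.range m, ∑ a ∈ Finset.range q, F (a + j * q) := by
  induction m with
  | zero => simp
  | succ m ih =>
    rw [Nat.succ_mul, Finset.sum_range_add, ih, Finset.sum_range_succ]
    simp only [add_comm]

theorem norm_prime_lt_one : ‖(p : ℚ_[p])‖ < 1 := by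
  rw [Padic.norm_p]
  exact inv_lt_one_of_one_lt₀ (by exact_mod_cast (Fact.out : p.Prime).one_lt)

theorem norm_natCast_mul_prime_pow_le (j N : ℕ) :
    ‖((j * p ^ N : ℕ) : ℤ_[p])‖ ≤ ‖(p : ℚ_[p])‖ ^ N := by
  push_cast
  rw [norm_mul, norm_pow, PadicInt.norm_def (z := (p : ℤ_[p])), PadicInt.coe_natCast]
  exact mul_le_of_le_one_left (by positivity) (PadicInt.norm_le_one _)

/-- The sum of a Lipschitz function over `0, …, p ^ N - 1` tends to zero. -/
theorem tendsto_sum_range_pow_of_lipschitz {h : ℤ_[p] → ℚ_[p]} {C : ℝ}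
    (hC : ∀ x y : ℤ_[p], ‖h (x + y) - h x‖ ≤ C * ‖y‖) :
    Tendsto (fun N => ∑ a ∈ Finset.range (p ^ N), h (a : ℤ_[p])) atTop (𝓝 0) := by
  have hp0 : 0 < ‖(p : ℚ_[p])‖ := by
    simpa using (Fact.out : p.Prime).pos
  have hC0 : 0 ≤ C := by simpa using (norm_nonneg _).trans (hC 0 1)
  set r : ℝ := ‖(p : ℚ_[p])‖ with hr
  obtain ⟨D, hD0, hDC, hDh⟩ : ∃ D : ℝ, 0 ≤ D ∧ C ≤ D * r ∧ ‖h 0‖ ≤ D := by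
    refine ⟨C / r + ‖h 0‖, by positivity, ?_, by linarith [div_nonneg hC0 hp0.le]⟩
    have : C / r * r = C := div_mul_cancel₀ _ hp0.ne'
    nlinarith [norm_nonneg (h 0)]
  have bound : ∀ N, ‖∑ a ∈ Finset.range (p ^ N), h (a : ℤ_[p])‖ ≤ D * r ^ N := by
    intro N
    induction N with
    | zero => simpa using hDh
    | succ N ih =>
      have key : ∑ a ∈ Finset.range (p ^ (N + 1)), h (a : ℤ_[p]) =
          p * ∑ a ∈ Finset.range (p ^ N), h (a : ℤ_[p]) +
          ∑ j ∈ Finset.range p, ∑ a ∈ Finset.range (p ^ N),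
            (h ((a : ℤ_[p]) + (j * p ^ N : ℕ)) - h a) := by
        rw [pow_succ', sum_range_mul_eq]
        simp only [Finset.sum_sub_distrib, Finset.sum_const, Finset.card_range, nsmul_eq_mul,
          Nat.cast_add]
        ring
      rw [key, pow_succ]
      refine (IsUltrametricDist.norm_add_le_max _ _).trans (max_le ?_ ?_)
      · rw [norm_mul, ← hr]
        nlinarith
      · have hnn : 0 ≤ D * (r ^ N * r) := by positivity
        refine IsUltrametricDist.norm_sum_le_of_forall_le_of_nonneg hnn fun j _ =>
          IsUltrametricDist.norm_sum_le_of_forall_le_of_nonneg hnn fun a _ => (hC _ _).trans ?_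
        have hy : ‖((j * p ^ N : ℕ) : ℤ_[p])‖ ≤ r ^ N := norm_natCast_mul_prime_pow_le j N
        calc C * _ ≤ (D * r) * r ^ N := mul_le_mul hDC hy (norm_nonneg _) (by positivity)
          _ = _ := by ring
  refine squeeze_zero_norm bound ?_
  simpa using (tendsto_pow_atTop_nhds_zero_of_lt_one hp0.le norm_prime_lt_one).const_mul D

theorem FirstOrderExpansion.exists_tendsto_volkSum {g h : ℤ_[p] → ℚ_[p]} {C : ℝ}
    (hg : FirstOrderExpansion g h C) : ∃ L, Tendsto (volkSum p g) atTop (𝓝 L) := by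
  refine cauchySeq_tendsto_of_complete
    (NonarchimedeanAddGroup.cauchySeq_of_tendsto_sub_nhds_zero ?_)
  have hpne : (p : ℚ_[p]) ≠ 0 := by exact_mod_cast (Fact.out : p.Prime).ne_zero
  have hC0 := hg.const_nonneg
  have key : ∀ N, volkSum p g (N + 1) - volkSum p g N =
      (p : ℚ_[p])⁻¹ * (∑ j ∈ Finset.range p, (j : ℚ_[p])) *
          ∑ a ∈ Finset.range (p ^ N), h (a : ℤ_[p]) +
        ((p : ℚ_[p]) ^ (N + 1))⁻¹ * ∑ j ∈ Finset.range p, ∑ a ∈ Finset.range (p ^ N),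
          (g ((a : ℤ_[p]) + (j * p ^ N : ℕ)) - g a - ((j * p ^ N : ℕ) : ℤ_[p]) * h a) := by
    intro N
    simp only [volkSum]
    nth_rewrite 2 [pow_succ']
    rw [sum_range_mul_eq]
    simp only [Finset.sum_sub_distrib, Finset.sum_const, Finset.card_range, nsmul_eq_mul,
      Nat.cast_add, PadicInt.coe_natCast, ← Finset.mul_sum, ← Finset.sum_mul]
    have : ∑ j ∈ Finset.range p, ((j * p ^ N : ℕ) : ℚ_[p]) =
        (∑ j ∈ Finset.range p, (j : ℚ_[p])) * p ^ N := by
      rw [Finset.sum_mul]; push_cast; rfl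
    rw [this]
    field_simp
    ring
  have hlim₁ := (tendsto_sum_range_pow_of_lipschitz hg.norm_coeff_add_sub_le).const_mul
    ((p : ℚ_[p])⁻¹ * (∑ j ∈ Finset.range p, (j : ℚ_[p])))
  have hlim₂ : Tendsto (fun N => ((p : ℚ_[p]) ^ (N + 1))⁻¹ *
      ∑ j ∈ Finset.range p, ∑ a ∈ Finset.range (p ^ N),
        (g ((a : ℤ_[p]) + (j * p ^ N : ℕ)) - g a - ((j * p ^ N : ℕ) : ℤ_[p]) * h a))
      atTop (𝓝 0) := by
    set r : ℝ := ‖(p : ℚ_[p])‖ with hr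
    have hp0 : 0 < r := norm_pos_iff.mpr hpne
    have hbound : Tendsto (fun N : ℕ => C * r⁻¹ * r ^ N) atTop (𝓝 0) := by
      simpa using (tendsto_pow_atTop_nhds_zero_of_lt_one hp0.le norm_prime_lt_one).const_mul
        (C * r⁻¹)
    refine squeeze_zero_norm (fun N => ?_) hbound
    have hsum : ‖∑ j ∈ Finset.range p, ∑ a ∈ Finset.range (p ^ N),
        (g ((a : ℤ_[p]) + (j * p ^ N : ℕ)) - g a - ((j * p ^ N : ℕ) : ℤ_[p]) * h a)‖ ≤
        C * (r ^ N) ^ 2 := by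
      have hnn : 0 ≤ C * (r ^ N) ^ 2 := by positivity
      refine IsUltrametricDist.norm_sum_le_of_forall_le_of_nonneg hnn fun j _ =>
        IsUltrametricDist.norm_sum_le_of_forall_le_of_nonneg hnn fun a _ => (hg _ _).trans ?_
      have hy : ‖((j * p ^ N : ℕ) : ℤ_[p])‖ ≤ r ^ N := norm_natCast_mul_prime_pow_le j N
      gcongr
    rw [norm_mul, norm_inv, norm_pow, ← hr]
    calc (r ^ (N + 1))⁻¹ * _ ≤ (r ^ (N + 1))⁻¹ * (C * (r ^ N) ^ 2) := by gcongr
      _ = C * r⁻¹ * r ^ N := by field_simp; ring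
  have := hlim₁.add hlim₂
  rw [mul_zero, add_zero] at this
  exact this.congr fun N => (key N).symm

theorem EverywhereAnalytic.exists_firstOrderExpansion {f : ℤ_[p] → ℤ_[p]}
    (hf : EverywhereAnalytic p f) :
    ∃ h, FirstOrderExpansion (fun x => (f x : ℚ_[p])) h 1 := by
  obtain ⟨c, hc1, hc0, hfc⟩ := hf
  have hsum (z : ℕ → ℤ_[p]) : Summable fun k => c k * (z k : ℚ_[p]) := by
    refine NonarchimedeanAddGroup.summable_of_tendsto_cofinite_zero ?_
    rw [Nat.cofinite_eq_atTop]
    refine squeeze_zero_norm (fun k => ?_) (tendsto_zero_iff_norm_tendsto_zero.mp hc0)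
    rw [norm_mul]
    exact mul_le_of_le_one_right (norm_nonneg _) (PadicInt.norm_le_one (z k))
  refine ⟨fun x => ∑' k, c k * ((k * x ^ (k - 1) : ℤ_[p]) : ℚ_[p]), fun x y => ?_⟩
  have hexp (k : ℕ) := (Polynomial.powAddExpansion x y k).2
  set z : ℕ → ℤ_[p] := fun k => (Polynomial.powAddExpansion x y k).1 with hz
  have hpow (w : ℤ_[p]) : (f w : ℚ_[p]) = ∑' k, c k * ((w ^ k : ℤ_[p]) : ℚ_[p]) := by
    simpa using hfc w
  have key : (f (x + y) : ℚ_[p]) - f x -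
      y * ∑' k, c k * ((k * x ^ (k - 1) : ℤ_[p]) : ℚ_[p]) =
      ∑' k, c k * ((z k * y ^ 2 : ℤ_[p]) : ℚ_[p]) := by
    rw [hpow, hpow, ← tsum_mul_left, ← (hsum _).tsum_sub (hsum _),
      ← ((hsum _).sub (hsum _)).tsum_sub ((hsum _).mul_left _)]
    refine tsum_congr fun k => ?_
    rw [hexp k]
    push_cast
    ring
  dsimp only
  rw [key, one_mul]
  refine IsUltrametricDist.norm_tsum_le_of_forall_le_of_nonneg (by positivity) fun k => ?_
  rw [norm_mul, ← PadicInt.norm_def, norm_mul, norm_pow]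
  have h1 := mul_le_one₀ (hc1 k) (norm_nonneg _) (PadicInt.norm_le_one (z k))
  rw [← mul_assoc]
  exact mul_le_of_le_one_left (by positivity) h1

theorem limUnder_congr_of_tendsto_sub {α E : Type*} [SeminormedAddCommGroup E] {l : Filter α}
    {u v : α → E} (h : Tendsto (fun n => u n - v n) l (𝓝 0)) [Nonempty E] :
    limUnder l u = limUnder l v := by
  have : (fun x => map u l ≤ 𝓝 x) = fun x => map v l ≤ 𝓝 x := by
    funext x
    refine propext ⟨fun hu => ?_, fun hv => ?_⟩
    · change Tendsto v l (𝓝 x)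
      simpa using Tendsto.sub (show Tendsto u l (𝓝 x) from hu) h
    · change Tendsto u l (𝓝 x)
      simpa using Tendsto.add (show Tendsto v l (𝓝 x) from hv) h
  unfold limUnder lim
  rw [this]

/-- The Teichmüller representative depends only on the residue class. -/
theorem teich_eq_of_norm_sub_lt_one {x y : ℚ_[p]} (hx : ‖x‖ ≤ 1) (hy : ‖y‖ ≤ 1)
    (hxy : ‖x - y‖ < 1) : teich p x = teich p y := by
  refine limUnder_congr_of_tendsto_sub ?_
  obtain ⟨x, rfl⟩ : ∃ z : ℤ_[p], (z : ℚ_[p]) = x := ⟨⟨x, hx⟩, rfl⟩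
  obtain ⟨y, rfl⟩ : ∃ z : ℤ_[p], (z : ℚ_[p]) = y := ⟨⟨y, hy⟩, rfl⟩
  have hdvd : (p : ℤ_[p]) ∣ x - y := by
    rw [← PadicInt.norm_lt_one_iff_dvd, PadicInt.norm_def]
    exact_mod_cast hxy
  have hlim := tendsto_pow_atTop_nhds_zero_of_lt_one (norm_nonneg (p : ℚ_[p])) norm_prime_lt_one
  refine squeeze_zero_norm (fun n => ?_) hlim
  obtain ⟨w, hw⟩ := dvd_sub_pow_of_dvd_sub hdvd n
  have hw' : (x : ℚ_[p]) ^ p ^ n - (y : ℚ_[p]) ^ p ^ n = (p : ℚ_[p]) ^ (n + 1) * w := by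
    exact_mod_cast congrArg (fun t : ℤ_[p] => (t : ℚ_[p])) hw
  rw [hw', norm_mul, norm_pow, pow_succ, mul_assoc]
  exact mul_le_of_le_one_right (by positivity)
    (mul_le_one₀ norm_prime_lt_one.le (norm_nonneg _) (PadicInt.norm_le_one w))

theorem norm_unitPart {x : ℚ_[p]} (hx : x ≠ 0) : ‖unitPart p x‖ = 1 := by
  have hpne : (p : ℝ) ≠ 0 := by exact_mod_cast (Fact.out : p.Prime).ne_zero
  rw [unitPart, norm_mul, Padic.norm_eq_zpow_neg_valuation hx, Padic.norm_p_zpow, neg_neg,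
    ← zpow_add₀ hpne, neg_add_cancel, zpow_zero]

theorem valuation_eq_of_norm_eq {x y : ℚ_[p]} (hx : x ≠ 0) (h : ‖x‖ = ‖y‖) :
    x.valuation = y.valuation := by
  have hy : y ≠ 0 := norm_ne_zero_iff.mp (h ▸ norm_ne_zero_iff.mpr hx)
  rw [Padic.norm_eq_zpow_neg_valuation hx, Padic.norm_eq_zpow_neg_valuation hy] at h
  have hp1 : (1 : ℝ) < p := by exact_mod_cast (Fact.out : p.Prime).one_lt
  exact neg_injective (zpow_right_injective₀ (by linarith) hp1.ne' h)

/-- Translating by an element of smaller absolute value does not change `ω_v`. -/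
theorem angle_add_eq {x y : ℚ_[p]} (hxy : ‖y‖ < ‖x‖) :
    angle p (x + y) = (omegaV p x)⁻¹ * (x + y) := by
  have hx : x ≠ 0 := norm_pos_iff.mp ((norm_nonneg y).trans_lt hxy)
  have hnorm : ‖x + y‖ = ‖x‖ := by
    rw [IsUltrametricDist.norm_add_eq_max_of_norm_ne_norm hxy.ne', max_eq_left hxy.le]
  have hxy0 : x + y ≠ 0 := norm_ne_zero_iff.mp (hnorm ▸ norm_ne_zero_iff.mpr hx)
  have hval : (x + y).valuation = x.valuation := valuation_eq_of_norm_eq hxy0 hnorm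
  have hteich : teich p (unitPart p (x + y)) = teich p (unitPart p x) := by
    refine teich_eq_of_norm_sub_lt_one (norm_unitPart hxy0).le (norm_unitPart hx).le ?_
    rw [unitPart, unitPart, hval, ← sub_mul, add_sub_cancel_left, norm_mul]
    have h1 : ‖x‖ * ‖(p : ℚ_[p]) ^ (-x.valuation)‖ = 1 := by
      rw [← norm_mul]; exact norm_unitPart hx
    have h2 : 0 < ‖(p : ℚ_[p]) ^ (-x.valuation)‖ := by
      refine pos_of_mul_pos_right (h1 ▸ one_pos) (norm_nonneg x)
    rw [← h1]
    exact mul_lt_mul_of_pos_right hxy h2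
  rw [omegaV, angle, angle, hteich, unitPart, unitPart, hval]
  field_simp

end

end PZeta

/-- special values of `ζ_p^f` at non-positive integers: for `n ≥ 1` both
Volkenborn integrals `L = ∫_{ℤ_p} ⟨λ+f(a)⟩^n da` and `M = ∫_{ℤ_p} (λ+f(a))^n da = B_n^f(λ)`
exist, `L = ω_v(λ)^{-n}·M`, and `ζ_p^f(1-n,λ) = -(1/n)·L = -(1/n)·ω_v(λ)^{-n}·B_n^f(λ)`. -/
theorem zetaH_special_values (p : ℕ) [Fact p.Prime] (hp : Odd p)
    (f : ℤ_[p] → ℤ_[p]) (hf : EverywhereAnalytic p f)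
    (lam : ℚ_[p]) (hlam : 1 < ‖lam‖) (n : ℕ) (hn : 1 ≤ n) :
    ∃ L M : ℚ_[p],
      Filter.Tendsto (volkSum p fun a => (angle p (lam + (f a : ℚ_[p]))) ^ n)
        Filter.atTop (nhds L) ∧
      Filter.Tendsto (volkSum p fun a => (lam + (f a : ℚ_[p])) ^ n)
        Filter.atTop (nhds M) ∧
      L = ((omegaV p lam) ^ n)⁻¹ * M ∧
      -((n : ℚ_[p]))⁻¹ * L = -(1 / (n : ℚ_[p])) * ((omegaV p lam) ^ n)⁻¹ * M := by
  obtain ⟨h, hh⟩ := hf.exists_firstOrderExpansion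
  obtain ⟨h', C', hpow⟩ := (hh.const_add lam).exists_pow n
  obtain ⟨M, hM⟩ := hpow.exists_tendsto_volkSum
  have hangle (a : ℤ_[p]) : angle p (lam + (f a : ℚ_[p])) ^ n =
      ((omegaV p lam) ^ n)⁻¹ * (lam + (f a : ℚ_[p])) ^ n := by
    rw [angle_add_eq ((PadicInt.norm_le_one (f a)).trans_lt hlam), mul_pow, inv_pow]
  refine ⟨((omegaV p lam) ^ n)⁻¹ * M, M, ?_, hM, rfl, by rw [one_div, mul_assoc]⟩
  refine (hM.const_mul ((omegaV p lam) ^ n)⁻¹).congr fun N => ?_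
  simp only [volkSum, hangle, ← Finset.mul_sum]
  ring
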